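/- Let ‖·‖_μ be defined on r×r unitaries by ‖U‖_μ = Σ_j μ_j |θ_j|↓, where θ_j ∈ (−π,π] are the eigenangles of U sorted so that |θ₁|↓ ≥ ⋯ ≥ |θ_r|↓, and μ₁ ≥ ⋯ ≥ μ_r ≥ 0 are fixed. Then for the special case μ = (1,0,…,0) (the max time-energy) the multiplicative triangle inequality ‖UV‖_max ≤ ‖U‖_max + ‖V‖_max holds, provided ‖U‖_max + ‖V‖_max ≤ π. -/

import Mathlib

open scoped InnerProductSpace ComplexOrder in
/-- A unitary operator whose spectrum lies within angle `α ≤ π` of `1` has numerical range in the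
half-plane `cos α ≤ re z`. -/
theorem cos_mul_norm_sq_le_re_inner_of_mem_unitary {E : Type*} [NormedAddCommGroup E]
    [InnerProductSpace ℂ E] [CompleteSpace E] {T : E →L[ℂ] E} (hT : T ∈ unitary (E →L[ℂ] E))
    {α : ℝ} (hα : α ≤ Real.pi) (h : ∀ μ ∈ spectrum ℂ T, |Complex.arg μ| ≤ α) (x : E) :
    Real.cos α * ‖x‖ ^ 2 ≤ (⟪x, T x⟫_ℂ).re := by
  have hnormal : IsStarNormal T := ⟨hT.1.trans hT.2.symm⟩
  have hpos : 0 ≤ cfc (fun z : ℂ => z + star z - ((2 * Real.cos α : ℝ) : ℂ)) T := by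
    refine cfc_nonneg fun z hz => ?_
    have hz1 : ‖z‖ = 1 := by
      simpa using spectrum.subset_circle_of_unitary hT hz
    have hre : Real.cos α ≤ z.re := by
      have hcos : Real.cos z.arg = z.re := by
        rw [Complex.cos_arg (norm_ne_zero_iff.mp (by simp [hz1])), hz1, div_one]
      rw [← hcos, ← Real.cos_abs z.arg]
      exact Real.cos_le_cos_of_nonneg_of_le_pi (abs_nonneg _) hα (h z hz)
    rw [Complex.star_def, Complex.add_conj, ← Complex.ofReal_sub, Complex.zero_le_real]
    linarith
  rw [cfc_sub .., cfc_add .., cfc_id' .., cfc_star_id .., cfc_const ..,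
    ContinuousLinearMap.nonneg_iff_isPositive] at hpos
  have hx := hpos.re_inner_nonneg_right x
  have hsymm : (⟪x, star T x⟫_ℂ).re = (⟪x, T x⟫_ℂ).re := by
    rw [ContinuousLinearMap.star_eq_adjoint, ContinuousLinearMap.adjoint_inner_right]
    exact inner_re_symm (𝕜 := ℂ) (T x) x
  have hself : (⟪x, x⟫_ℂ).re = ‖x‖ ^ 2 := inner_self_eq_norm_sq (𝕜 := ℂ) x
  simp only [sub_apply, add_apply,
    Algebra.algebraMap_eq_smul_one, smul_apply,
    one_apply_eq_self, inner_sub_right, inner_add_right, inner_smul_right,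
    RCLike.re_to_complex, Complex.sub_re, Complex.add_re, Complex.re_ofReal_mul,
    hsymm, hself] at hx
  linarith

open scoped InnerProductSpace in
/-- The eigenvalues of a product of two unitary operators whose spectra lie within angles `α` and
`β` of `1` lie within angle `α + β` of `1`. -/
theorem abs_arg_le_add_of_mul_apply_eq_smul {E : Type*} [NormedAddCommGroup E]
    [InnerProductSpace ℂ E] [CompleteSpace E] {S T : E →L[ℂ] E}
    (hS : S ∈ unitary (E →L[ℂ] E)) (hT : T ∈ unitary (E →L[ℂ] E)) {α β : ℝ}
    (hα₀ : 0 ≤ α) (hβ₀ : 0 ≤ β) (hα : α ≤ Real.pi) (hβ : β ≤ Real.pi)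
    (hSe : ∀ μ ∈ spectrum ℂ S, |Complex.arg μ| ≤ α)
    (hTe : ∀ μ ∈ spectrum ℂ T, |Complex.arg μ| ≤ β)
    {μ : ℂ} {x : E} (hx : x ≠ 0) (hμ : (S * T) x = μ • x) :
    |Complex.arg μ| ≤ α + β := by
  let _ : InnerProductSpace ℝ E := InnerProductSpace.rclikeToReal ℂ E
  have hinner (y z : E) : ⟪y, z⟫_ℝ = (⟪y, z⟫_ℂ).re := real_inner_eq_re_inner ℂ y z
  have hangle {R : E →L[ℂ] E} (hR : R ∈ unitary (E →L[ℂ] E)) {γ : ℝ} (hγ₀ : 0 ≤ γ)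
      (hγ : γ ≤ Real.pi) (hRe : ∀ μ ∈ spectrum ℂ R, |Complex.arg μ| ≤ γ) {y : E} (hy : y ≠ 0) :
      InnerProductGeometry.angle y (R y) ≤ γ := by
    rw [InnerProductGeometry.angle, ← Real.arccos_cos hγ₀ hγ]
    refine Real.arccos_le_arccos ?_
    have hy' : 0 < ‖y‖ := norm_pos_iff.mpr hy
    rw [hinner, ContinuousLinearMap.norm_map_of_mem_unitary hR, le_div_iff₀ (by positivity), ← sq]
    exact cos_mul_norm_sq_le_re_inner_of_mem_unitary hR hγ hRe y
  have hx' : 0 < ‖x‖ := norm_pos_iff.mpr hx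
  have hTx : T x ≠ 0 := by
    rw [← norm_ne_zero_iff, ContinuousLinearMap.norm_map_of_mem_unitary hT]
    exact hx'.ne'
  have hμ1 : ‖μ‖ = 1 := by
    have := ContinuousLinearMap.norm_map_of_mem_unitary (mul_mem hS hT) x
    rw [hμ, norm_smul] at this
    exact mul_right_cancel₀ hx'.ne' (this.trans (one_mul _).symm)
  have harg : InnerProductGeometry.angle x (S (T x)) = |Complex.arg μ| := by
    have hμ' : S (T x) = μ • x := hμ
    have hself : ⟪x, x⟫_ℂ = ((‖x‖ ^ 2 : ℝ) : ℂ) := by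
      rw [inner_self_eq_norm_sq_to_K]; norm_cast
    rw [InnerProductGeometry.angle, hμ', hinner, inner_smul_right, norm_smul, hμ1, one_mul, hself,
      Complex.re_mul_ofReal, ← sq, mul_div_cancel_right₀ _ (by positivity),
      ← Real.arccos_cos (abs_nonneg _) (Complex.abs_arg_le_pi μ), Real.cos_abs,
      Complex.cos_arg (norm_ne_zero_iff.mp (by simp [hμ1])), hμ1, div_one]
  calc |Complex.arg μ| = InnerProductGeometry.angle x (S (T x)) := harg.symm
    _ ≤ InnerProductGeometry.angle x (T x) + InnerProductGeometry.angle (T x) (S (T x)) :=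
      InnerProductGeometry.angle_le_angle_add_angle _ _ _
    _ ≤ β + α := add_le_add (hangle hT hβ₀ hβ hTe hx) (hangle hS hα₀ hα hSe hTx)
    _ = α + β := add_comm _ _

theorem stmt19 {m : ℕ} (U V : Matrix (Fin m) (Fin m) ℂ)
    (hU : U ∈ Matrix.unitaryGroup (Fin m) ℂ) (hV : V ∈ Matrix.unitaryGroup (Fin m) ℂ)
    (α β : ℝ) (hα : 0 ≤ α) (hβ : 0 ≤ β) (hαβ : α + β ≤ Real.pi)
    (hUe : ∀ μ ∈ spectrum ℂ U, |Complex.arg μ| ≤ α)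
    (hVe : ∀ μ ∈ spectrum ℂ V, |Complex.arg μ| ≤ β) :
    ∀ μ ∈ spectrum ℂ (U * V), |Complex.arg μ| ≤ α + β := by
  intro μ hμ
  let Φ := Matrix.toEuclideanCLM (n := Fin m) (𝕜 := ℂ)
  rw [← Matrix.spectrum_toLin', ← Module.End.hasEigenvalue_iff_mem_spectrum] at hμ
  obtain ⟨v, hv⟩ := hμ.exists_hasEigenvector
  refine abs_arg_le_add_of_mul_apply_eq_smul (S := Φ U) (T := Φ V) (x := WithLp.toLp 2 v)
    (Unitary.map_mem Φ hU) (Unitary.map_mem Φ hV) hα hβ (by linarith) (by linarith)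
    (by rwa [AlgEquiv.spectrum_eq]) (by rwa [AlgEquiv.spectrum_eq]) (by simpa using hv.2) ?_
  rw [← map_mul, Matrix.toEuclideanCLM_toLp, ← WithLp.toLp_smul, ← hv.apply_eq_smul,
    Matrix.toLin'_apply]
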